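/- Under the interpolated gain-scheduling setup, suppose the rate condition sup_{t≥0}|ρ̇(t)| ≤ min_i { λ_min(Qᵢ) · [ sup_k ‖X_{i,ρᵏ⁺¹} − X_{i,ρᵏ}‖ / (ρ̄ᵏ − ρ̲ᵏ⁺¹) ]⁻¹ } holds. Then, in the absence of disturbances (w₀ ≡ 0, wᵢ ≡ 0, wᵢⱼ ≡ 0), for every solution of the parameter-varying closed-loop system with the interpolated protocol gains Kᵢⱼ(ρ(t)), Lᵢ(ρ(t)), there exist constants c, ω > 0 such that ‖x(t) − xᵢ(t)‖² ≤ c e^{−ωt} for all i = 1,…,N and all t ≥ 0. -/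

import Mathlib

open MeasureTheory Matrix Set Filter

noncomputable section

/-- Frobenius norm of a square real matrix (a fixed choice of matrix norm). -/
def frobNorm {n : ℕ} (M : Matrix (Fin n) (Fin n) ℝ) : ℝ :=
  Real.sqrt (∑ i, ∑ j, (M i j) ^ 2)

/-- A function `f : [0,∞) → ℝ^k` belongs to `L₂[0,∞)` (its squared Euclidean
norm is integrable on `[0,∞)`). -/
def IsL2 {k : ℕ} (f : ℝ → Fin k → ℝ) : Prop :=
  MeasureTheory.IntegrableOn (fun t => f t ⬝ᵥ f t) (Set.Ici 0) MeasureTheory.volume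

/-- The data of the multi-agent network: the directed graph (given by the
in-neighbourhood sets `V i`, with no self-loops), the coefficient matrices of the
reference system, the agents, the measurements and the communication channels, the
Lipschitz-bound matrix `R`, the performance weights `Q i`, and the constants
`γ` (`gam`) and `δ i`. -/
structure NetData (n l m r r0 N : ℕ) where
  V : Fin N → Finset (Fin N)
  B1 : Matrix (Fin n) (Fin l) ℝ
  B20 : Matrix (Fin n) (Fin r0) ℝ
  B2 : Fin N → Matrix (Fin n) (Fin r) ℝ
  C2 : Fin N → Matrix (Fin m) (Fin n) ℝ
  D2 : Fin N → Matrix (Fin m) (Fin r) ℝ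
  H : Fin N → Fin N → Matrix (Fin m) (Fin n) ℝ
  G : Fin N → Fin N → Matrix (Fin m) (Fin r) ℝ
  R : Matrix (Fin n) (Fin n) ℝ
  Q : Fin N → Matrix (Fin n) (Fin n) ℝ
  gam : ℝ
  δ : Fin N → ℝ

namespace NetData

variable {n l m r r0 N : ℕ} (d : NetData n l m r r0 N)

def E (i : Fin N) : Matrix (Fin m) (Fin m) ℝ := d.D2 i * (d.D2 i)ᵀ

def F (i j : Fin N) : Matrix (Fin m) (Fin m) ℝ := d.G i j * (d.G i j)ᵀ

/-- in-degree `p i` -/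
def pdeg (i : Fin N) : ℕ := (d.V i).card

/-- out-degree `q i` -/
def qdeg (i : Fin N) : ℕ := (Finset.univ.filter fun j => i ∈ d.V j).card

/-- Standing assumptions: no self-loops, `E₂ᵢ ≻ 0`, `Fᵢⱼ ≻ 0` on edges,
`R ⪰ 0`, `γ > 0`, `δᵢ > 0`, `Qᵢ ≻ 0`. -/
def Standing : Prop :=
  (∀ i, i ∉ d.V i) ∧ (∀ i, (d.E i).PosDef) ∧ (∀ i j, j ∈ d.V i → (d.F i j).PosDef)
    ∧ d.R.PosSemidef ∧ 0 < d.gam ∧ (∀ i, 0 < d.δ i) ∧ (∀ i, (d.Q i).PosDef)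

/-- The global Lipschitz condition (4) on the nonlinearity `φ`. -/
def LipOK (φ : (Fin n → ℝ) → Fin l → ℝ) : Prop :=
  ∀ a b : Fin n → ℝ, (φ a - φ b) ⬝ᵥ (φ a - φ b) ≤ (a - b) ⬝ᵥ (d.R *ᵥ (a - b))

def Acl (Aρ : Matrix (Fin n) (Fin n) ℝ) (i : Fin N) : Matrix (Fin n) (Fin n) ℝ :=
  Aρ + d.δ i • (1 : Matrix (Fin n) (Fin n) ℝ) + d.B2 i * (d.D2 i)ᵀ * (d.E i)⁻¹ * d.C2 i

/-- The matrix `Sᵢ(ρ)` of the coupled LMIs (12), evaluated at `A(ρ) = Aρ`. -/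
def Smat (Aρ : Matrix (Fin n) (Fin n) ℝ) (X : Fin N → Matrix (Fin n) (Fin n) ℝ)
    (i : Fin N) : Matrix (Fin n) (Fin n) ℝ :=
  X i * d.Acl Aρ i + (d.Acl Aρ i)ᵀ * X i
    + ((d.pdeg i + d.qdeg i : ℕ) : ℝ) • (1 : Matrix (Fin n) (Fin n) ℝ)
    - d.gam ^ 2 • ((d.C2 i)ᵀ * (d.E i)⁻¹ * d.C2 i)
    - d.gam ^ 2 • (∑ j ∈ d.V i, (d.H i j)ᵀ * (d.F i j)⁻¹ * d.H i j)
    + d.Q i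

/-- The quadratic form of the reduced coupled LMI (18):
`z ↦ zᵀ [[Sᵢ(ρ)+τᵢR, Tᵢ],[Tᵢᵀ, −Υᵢ]] z` for `z = (ξ, a, bv, c, (v j)_{j ∈ V i})`. -/
def redQF (Aρ : Matrix (Fin n) (Fin n) ℝ) (τ : Fin N → ℝ)
    (X : Fin N → Matrix (Fin n) (Fin n) ℝ) (i : Fin N)
    (ξ : Fin n → ℝ) (a : Fin r0 → ℝ) (bv : Fin r → ℝ) (c : Fin l → ℝ)
    (v : Fin N → Fin n → ℝ) : ℝ :=
  ξ ⬝ᵥ (d.Smat Aρ X i *ᵥ ξ) + τ i * (ξ ⬝ᵥ (d.R *ᵥ ξ))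
    + 2 * (ξ ⬝ᵥ ((X i * d.B20) *ᵥ a))
    + 2 * (ξ ⬝ᵥ ((X i * d.B2 i *
        ((1 : Matrix (Fin r) (Fin r) ℝ) - (d.D2 i)ᵀ * (d.E i)⁻¹ * d.D2 i)) *ᵥ bv))
    + 2 * (ξ ⬝ᵥ ((X i * d.B1) *ᵥ c))
    + 2 * ∑ j ∈ d.V i,
        ξ ⬝ᵥ ((d.gam ^ 2 • ((d.H i j)ᵀ * (d.F i j)⁻¹ * d.H i j)
          - (1 : Matrix (Fin n) (Fin n) ℝ)) *ᵥ v j)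
    - d.gam ^ 2 * (a ⬝ᵥ a) - d.gam ^ 2 * (bv ⬝ᵥ bv) - τ i * (c ⬝ᵥ c)
    - ∑ j ∈ d.V i, (2 * d.δ j / ((d.qdeg j : ℝ) + 1)) * (v j ⬝ᵥ (X j *ᵥ v j))

/-- The reduced coupled LMIs (18): negative definiteness of each block matrix,
expressed via its quadratic form. -/
def ReducedLMI (Aρ : Matrix (Fin n) (Fin n) ℝ) (τ : Fin N → ℝ)
    (X : Fin N → Matrix (Fin n) (Fin n) ℝ) : Prop :=
  ∀ (i : Fin N) (ξ : Fin n → ℝ) (a : Fin r0 → ℝ) (bv : Fin r → ℝ) (c : Fin l → ℝ)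
    (v : Fin N → Fin n → ℝ),
    ¬(ξ = 0 ∧ a = 0 ∧ bv = 0 ∧ c = 0 ∧ ∀ j ∈ d.V i, v j = 0) →
    d.redQF Aρ τ X i ξ a bv c v < 0

/-- The quadratic form of the full coupled LMI (12), for
`z = (ξ, a, bv, c, (v j)_{j ∈ V i}, zz)`. -/
def fullQF (Aρ : Matrix (Fin n) (Fin n) ℝ) (α : ℝ) (τ θ : Fin N → ℝ)
    (X : Fin N → Matrix (Fin n) (Fin n) ℝ) (i : Fin N)
    (ξ : Fin n → ℝ) (a : Fin r0 → ℝ) (bv : Fin r → ℝ) (c : Fin l → ℝ)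
    (v : Fin N → Fin n → ℝ) (zz : Fin n → ℝ) : ℝ :=
  d.redQF Aρ τ X i ξ a bv c v + θ i * α ^ 2 * (ξ ⬝ᵥ ξ)
    + 2 * (ξ ⬝ᵥ (X i *ᵥ zz)) - θ i * (zz ⬝ᵥ zz)

/-- The coupled LMIs (12) at the point `ρ` (with `A(ρ) = Aρ`) with uncertainty
size `α`: negative definiteness of each block matrix, via its quadratic form. -/
def CoupledLMI (Aρ : Matrix (Fin n) (Fin n) ℝ) (α : ℝ) (τ θ : Fin N → ℝ)
    (X : Fin N → Matrix (Fin n) (Fin n) ℝ) : Prop :=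
  ∀ (i : Fin N) (ξ : Fin n → ℝ) (a : Fin r0 → ℝ) (bv : Fin r → ℝ) (c : Fin l → ℝ)
    (v : Fin N → Fin n → ℝ) (zz : Fin n → ℝ),
    ¬(ξ = 0 ∧ a = 0 ∧ bv = 0 ∧ c = 0 ∧ (∀ j ∈ d.V i, v j = 0) ∧ zz = 0) →
    d.fullQF Aρ α τ θ X i ξ a bv c v zz < 0

/-- Feasibility of the coupled LMIs (12): positivity of scalar variables,
positive definiteness of the `Xᵢ` and the LMIs themselves. -/
def Feasible (Aρ : Matrix (Fin n) (Fin n) ℝ) (α : ℝ) (τ θ : Fin N → ℝ)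
    (X : Fin N → Matrix (Fin n) (Fin n) ℝ) : Prop :=
  (∀ i, 0 < τ i) ∧ (∀ i, 0 < θ i) ∧ (∀ i, (X i).PosDef) ∧ d.CoupledLMI Aρ α τ θ X

/-- Interconnection gains `Kᵢⱼ = γ²Xᵢ⁻¹HᵢⱼᵀFᵢⱼ⁻¹`. -/
def Kgain (X : Fin N → Matrix (Fin n) (Fin n) ℝ) (i j : Fin N) :
    Matrix (Fin n) (Fin m) ℝ :=
  d.gam ^ 2 • ((X i)⁻¹ * (d.H i j)ᵀ * (d.F i j)⁻¹)

/-- Observer gains `Lᵢ = (γ²Xᵢ⁻¹C₂ᵢᵀ − B₂ᵢD₂ᵢᵀ)E₂ᵢ⁻¹`. -/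
def Lgain (X : Fin N → Matrix (Fin n) (Fin n) ℝ) (i : Fin N) :
    Matrix (Fin n) (Fin m) ℝ :=
  (d.gam ^ 2 • ((X i)⁻¹ * (d.C2 i)ᵀ) - d.B2 i * (d.D2 i)ᵀ) * (d.E i)⁻¹

/-- `x, (xa i)` is a solution of the closed-loop system: the reference system (5)
(with the extra uncertainty `ψ`), the agents (6), the measurements (3), and the
protocol (8) with (possibly time-varying) gains `K t i j`, `L t i`. -/
def ClosedLoop (Aρ : ℝ → Matrix (Fin n) (Fin n) ℝ)
    (φ : (Fin n → ℝ) → Fin l → ℝ) (ψ : ℝ → (Fin n → ℝ) → Fin n → ℝ)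
    (K : ℝ → Fin N → Fin N → Matrix (Fin n) (Fin m) ℝ)
    (L : ℝ → Fin N → Matrix (Fin n) (Fin m) ℝ)
    (w0 : ℝ → Fin r0 → ℝ) (w : Fin N → ℝ → Fin r → ℝ)
    (wE : Fin N → Fin N → ℝ → Fin r → ℝ)
    (x : ℝ → Fin n → ℝ) (xa : Fin N → ℝ → Fin n → ℝ) : Prop :=
  (∀ t ∈ Ici (0:ℝ),
    HasDerivAt x (Aρ t *ᵥ x t + d.B1 *ᵥ φ (x t) + d.B20 *ᵥ w0 t + ψ t (x t)) t) ∧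
  ∀ i, ∀ t ∈ Ici (0:ℝ),
    HasDerivAt (xa i)
      (Aρ t *ᵥ xa i t + d.B1 *ᵥ φ (xa i t) + ψ t (xa i t)
        + (L t i *ᵥ ((d.C2 i *ᵥ x t + d.D2 i *ᵥ w i t) - d.C2 i *ᵥ xa i t)
          + ∑ j ∈ d.V i, K t i j *ᵥ ((d.H i j *ᵥ xa j t + d.G i j *ᵥ wE i j t)
              - d.H i j *ᵥ xa i t))
        + d.B2 i *ᵥ w i t) t

/-- The disagreement function `Ψ_G` (11). -/
def disagree (e : Fin N → Fin n → ℝ) : ℝ :=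
  (1 / (N : ℝ)) * ∑ i, ∑ j ∈ d.V i, (e j - e i) ⬝ᵥ (e j - e i)

/-- `‖(x₀,w₀,w,w̄)‖²` with `P = diag[(1/N)Xᵢ]`. -/
def distSq (X : Fin N → Matrix (Fin n) (Fin n) ℝ) (x0 : Fin n → ℝ)
    (x0a : Fin N → Fin n → ℝ) (w0 : ℝ → Fin r0 → ℝ) (w : Fin N → ℝ → Fin r → ℝ)
    (wE : Fin N → Fin N → ℝ → Fin r → ℝ) : ℝ :=
  (1 / (N : ℝ)) * ∑ i, (x0 - x0a i) ⬝ᵥ (X i *ᵥ (x0 - x0a i))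
    + (∫ t in Ici (0:ℝ), w0 t ⬝ᵥ w0 t)
    + (1 / (N : ℝ)) * ∑ i, ((∫ t in Ici (0:ℝ), w i t ⬝ᵥ w i t)
        + ∑ j ∈ d.V i, ∫ t in Ici (0:ℝ), wE i j t ⬝ᵥ wE i j t)

end NetData

namespace NetData

section Quadratic

variable {n : ℕ}

lemma frobNorm_sq (M : Matrix (Fin n) (Fin n) ℝ) : frobNorm M ^ 2 = ∑ i, ∑ j, (M i j) ^ 2 :=
  Real.sq_sqrt (Finset.sum_nonneg fun _ _ => Finset.sum_nonneg fun _ _ => sq_nonneg _)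

lemma frobNorm_nonneg (M : Matrix (Fin n) (Fin n) ℝ) : 0 ≤ frobNorm M := Real.sqrt_nonneg _

lemma abs_entry_le_frobNorm (M : Matrix (Fin n) (Fin n) ℝ) (p q : Fin n) :
    |M p q| ≤ frobNorm M := by
  refine abs_le_of_sq_le_sq ?_ (frobNorm_nonneg M)
  rw [frobNorm_sq]
  calc M p q ^ 2 ≤ ∑ j, M p j ^ 2 :=
        Finset.single_le_sum (f := fun j => M p j ^ 2) (fun _ _ => sq_nonneg _) (Finset.mem_univ q)
    _ ≤ _ := Finset.single_le_sum (f := fun i => ∑ j, M i j ^ 2)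
        (fun _ _ => Finset.sum_nonneg fun _ _ => sq_nonneg _) (Finset.mem_univ p)

lemma dotProduct_self_nonneg_real {k : ℕ} (v : Fin k → ℝ) : 0 ≤ v ⬝ᵥ v :=
  Finset.sum_nonneg fun _ _ => mul_self_nonneg _

lemma dotProduct_sq_le (v w : Fin n → ℝ) : (v ⬝ᵥ w) ^ 2 ≤ (v ⬝ᵥ v) * (w ⬝ᵥ w) := by
  simpa [dotProduct, sq] using Finset.sum_mul_sq_le_sq_mul_sq Finset.univ v w

lemma mulVec_sq_le (M : Matrix (Fin n) (Fin n) ℝ) (v : Fin n → ℝ) :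
    (M *ᵥ v) ⬝ᵥ (M *ᵥ v) ≤ frobNorm M ^ 2 * (v ⬝ᵥ v) := by
  rw [frobNorm_sq, Finset.sum_mul]
  refine Finset.sum_le_sum fun i _ => ?_
  have := dotProduct_sq_le (M i) v
  simpa [mulVec, dotProduct, sq] using this

lemma abs_quadForm_le (M : Matrix (Fin n) (Fin n) ℝ) (v : Fin n → ℝ) :
    |v ⬝ᵥ (M *ᵥ v)| ≤ frobNorm M * (v ⬝ᵥ v) := by
  have h0 := dotProduct_self_nonneg_real v
  refine abs_le_of_sq_le_sq ?_ (mul_nonneg (frobNorm_nonneg M) h0)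
  calc (v ⬝ᵥ (M *ᵥ v)) ^ 2 ≤ (v ⬝ᵥ v) * ((M *ᵥ v) ⬝ᵥ (M *ᵥ v)) := dotProduct_sq_le _ _
    _ ≤ (v ⬝ᵥ v) * (frobNorm M ^ 2 * (v ⬝ᵥ v)) := by gcongr; exact mulVec_sq_le M v
    _ = _ := by ring

lemma quadForm_nonneg {k : ℕ} {X : Matrix (Fin k) (Fin k) ℝ} (hX : X.PosSemidef)
    (v : Fin k → ℝ) : 0 ≤ v ⬝ᵥ (X *ᵥ v) := by
  simpa using hX.dotProduct_mulVec_nonneg v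

lemma posDef_transpose {k : ℕ} {X : Matrix (Fin k) (Fin k) ℝ} (hX : X.PosDef) : Xᵀ = X := by
  simpa [conjTranspose_eq_transpose_of_trivial] using hX.isHermitian.eq

lemma dotProduct_mulVec_symm {X : Matrix (Fin n) (Fin n) ℝ} (hX : Xᵀ = X) (v w : Fin n → ℝ) :
    v ⬝ᵥ (X *ᵥ w) = w ⬝ᵥ (X *ᵥ v) := by
  rw [dotProduct_mulVec, ← mulVec_transpose, hX, dotProduct_comm]

/-- A positive definite matrix dominates a positive multiple of the identity. -/
lemma exists_coercive {X : Matrix (Fin n) (Fin n) ℝ} (hX : X.PosDef) :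
    ∃ μ > 0, ∀ v : Fin n → ℝ, μ * (v ⬝ᵥ v) ≤ v ⬝ᵥ (X *ᵥ v) := by
  set c := frobNorm X⁻¹ + 1 with hc
  have hcpos : 0 < c := by have := frobNorm_nonneg X⁻¹; positivity
  refine ⟨1 / c, by positivity, fun v => ?_⟩
  have hdet : IsUnit X.det := (isUnit_iff_isUnit_det X).1 hX.isUnit
  have h0 := dotProduct_self_nonneg_real v
  have hinv := (abs_le.1 (abs_quadForm_le X⁻¹ v)).2
  have hXi : X *ᵥ (X⁻¹ *ᵥ v) = v := by rw [mulVec_mulVec, mul_nonsing_inv _ hdet, one_mulVec]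
  have key := quadForm_nonneg hX.posSemidef (v - (1 / c) • (X⁻¹ *ᵥ v))
  have hs : (X⁻¹ *ᵥ v) ⬝ᵥ (X *ᵥ v) = v ⬝ᵥ v := by
    rw [dotProduct_mulVec_symm (posDef_transpose hX), hXi]
  rw [mulVec_sub, mulVec_smul, hXi, sub_dotProduct, dotProduct_sub, dotProduct_sub,
    smul_dotProduct, smul_dotProduct, dotProduct_smul, dotProduct_smul, hs,
    dotProduct_comm (X⁻¹ *ᵥ v) v] at key
  simp only [smul_eq_mul] at key
  have h1 : 1 / c * (1 / c * (v ⬝ᵥ (X⁻¹ *ᵥ v))) ≤ 1 / c * (v ⬝ᵥ v) := by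
    refine mul_le_mul_of_nonneg_left ?_ (by positivity)
    rw [one_div, inv_mul_le_iff₀ hcpos]
    nlinarith
  linarith

end Quadratic

section Interpolation

lemma lipschitz_glue {f : ℝ → ℝ} {C a b c : ℝ}
    (h₁ : ∀ s ∈ Icc a b, ∀ s' ∈ Icc a b, |f s - f s'| ≤ C * |s - s'|)
    (h₂ : ∀ s ∈ Icc b c, ∀ s' ∈ Icc b c, |f s - f s'| ≤ C * |s - s'|) :
    ∀ s ∈ Icc a c, ∀ s' ∈ Icc a c, |f s - f s'| ≤ C * |s - s'| := by
  intro s hs s' hs'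
  wlog hle : s ≤ s' generalizing s s' with H
  · rw [abs_sub_comm (f s), abs_sub_comm s]
    exact H s' hs' s hs (le_of_not_ge hle)
  rcases le_total s' b with h | h
  · exact h₁ s ⟨hs.1, hle.trans h⟩ s' ⟨hs'.1, h⟩
  rcases le_total b s with h' | h'
  · exact h₂ s ⟨h', hs.2⟩ s' ⟨h, hs'.2⟩
  have e₁ := h₁ s ⟨hs.1, h'⟩ b ⟨hs.1.trans h', le_rfl⟩
  have e₂ := h₂ b ⟨le_rfl, h.trans hs'.2⟩ s' ⟨h, hs'.2⟩
  calc |f s - f s'| ≤ |f s - f b| + |f b - f s'| := abs_sub_le _ _ _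
    _ ≤ C * |s - b| + C * |b - s'| := add_le_add e₁ e₂
    _ = C * |s - s'| := by
      rw [abs_of_nonpos (sub_nonpos.2 h'), abs_of_nonpos (sub_nonpos.2 h),
        abs_of_nonpos (sub_nonpos.2 hle)]
      ring

variable {M : ℕ} {grid u b : ℕ → ℝ}

/-- A piecewise affine interpolation is Lipschitz with any constant bounding its slopes. -/
lemma interpolation_lipschitz {g : ℕ → ℝ} {f : ℝ → ℝ} {C : ℝ} (hC0 : 0 ≤ C)
    (hcorner : ∀ k, k + 1 ≤ M - 1 → grid k < u k ∧ u k < b k ∧ b k < grid (k + 1))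
    (h1 : ∀ k, k + 1 ≤ M - 1 → ∀ s ∈ Icc (grid k) (u k), f s = g k)
    (h2 : ∀ k, k + 1 ≤ M - 1 → ∀ s ∈ Icc (u k) (b k),
      f s = ((b k - s) / (b k - u k)) * g k + ((s - u k) / (b k - u k)) * g (k + 1))
    (h3 : ∀ k, k + 1 ≤ M - 1 → ∀ s ∈ Icc (b k) (grid (k + 1)), f s = g (k + 1))
    (hC : ∀ k, k + 1 ≤ M - 1 → |g (k + 1) - g k| / (b k - u k) ≤ C) :
    ∀ k ≤ M - 1, ∀ s ∈ Icc (grid 0) (grid k), ∀ s' ∈ Icc (grid 0) (grid k),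
      |f s - f s'| ≤ C * |s - s'| := by
  intro k
  induction k with
  | zero =>
    intro _ s hs s' hs'
    rw [le_antisymm (hs.2.trans hs'.1) (hs'.2.trans hs.1)]
    simp
  | succ k ih =>
    intro hk
    refine lipschitz_glue (ih (by omega)) ?_
    have hbu : 0 < b k - u k := sub_pos.2 (hcorner k hk).2.1
    refine lipschitz_glue (b := u k) ?_ (lipschitz_glue (b := b k) ?_ ?_)
    · intro s hs s' hs'
      rw [h1 k hk s hs, h1 k hk s' hs']
      simp only [sub_self, abs_zero]
      positivity
    · intro s hs s' hs'
      rw [h2 k hk s hs, h2 k hk s' hs']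
      have : (b k - s) / (b k - u k) * g k + (s - u k) / (b k - u k) * g (k + 1) -
          ((b k - s') / (b k - u k) * g k + (s' - u k) / (b k - u k) * g (k + 1))
          = (g (k + 1) - g k) / (b k - u k) * (s - s') := by
        field_simp
        ring
      rw [this, abs_mul, abs_div, abs_of_pos hbu]
      exact mul_le_mul_of_nonneg_right (hC k hk) (abs_nonneg _)
    · intro s hs s' hs'
      rw [h3 k hk s hs, h3 k hk s' hs']
      simp only [sub_self, abs_zero]
      positivity

lemma exists_grid_interval {s : ℝ} :
    ∀ k ≤ M - 1, 1 ≤ k → s ∈ Icc (grid 0) (grid k) →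
      ∃ j, j + 1 ≤ M - 1 ∧ s ∈ Icc (grid j) (grid (j + 1)) := by
  intro k hk h1
  induction k, h1 using Nat.le_induction with
  | base => exact fun hs => ⟨0, hk, hs⟩
  | succ k _ ih =>
    intro hs
    rcases le_total s (grid k) with h | h
    · exact ih (by omega) ⟨hs.1, h⟩
    · exact ⟨k, hk, h, hs.2⟩

end Interpolation

section Inequalities

variable {n l m r r0 N : ℕ} (d : NetData n l m r r0 N)

/-- The matrix `C₂ᵢᵀ E₂ᵢ⁻¹ C₂ᵢ`. -/
def measInfo (i : Fin N) : Matrix (Fin n) (Fin n) ℝ := (d.C2 i)ᵀ * (d.E i)⁻¹ * d.C2 i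

/-- The matrix `Hᵢⱼᵀ Fᵢⱼ⁻¹ Hᵢⱼ`. -/
def linkInfo (i j : Fin N) : Matrix (Fin n) (Fin n) ℝ := (d.H i j)ᵀ * (d.F i j)⁻¹ * d.H i j

lemma quadForm_transpose (M : Matrix (Fin n) (Fin n) ℝ) (v : Fin n → ℝ) :
    v ⬝ᵥ (Mᵀ *ᵥ v) = v ⬝ᵥ (M *ᵥ v) := by
  rw [mulVec_transpose, dotProduct_mulVec, dotProduct_comm]

lemma finsetSum_mulVec {ι : Type*} (s : Finset ι) {k k' : ℕ} (f : ι → Matrix (Fin k) (Fin k') ℝ)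
    (v : Fin k' → ℝ) : (∑ j ∈ s, f j) *ᵥ v = ∑ j ∈ s, f j *ᵥ v := by
  classical
  induction s using Finset.induction_on with
  | empty => simp
  | insert a s ha ih => rw [Finset.sum_insert ha, Finset.sum_insert ha, add_mulVec, ih]

lemma redQF_eq (Aρ : Matrix (Fin n) (Fin n) ℝ) (τ : Fin N → ℝ)
    (X : Fin N → Matrix (Fin n) (Fin n) ℝ) (i : Fin N) (hX : (X i)ᵀ = X i)
    (ξ : Fin n → ℝ) (c : Fin l → ℝ) (v : Fin N → Fin n → ℝ) :
    d.redQF Aρ τ X i ξ 0 0 c v =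
      2 * (ξ ⬝ᵥ (X i *ᵥ (Aρ *ᵥ ξ))) + 2 * d.δ i * (ξ ⬝ᵥ (X i *ᵥ ξ))
      + 2 * (ξ ⬝ᵥ (X i *ᵥ ((d.B2 i * (d.D2 i)ᵀ * (d.E i)⁻¹ * d.C2 i) *ᵥ ξ)))
      + ((d.pdeg i : ℝ) + d.qdeg i) * (ξ ⬝ᵥ ξ) - d.gam ^ 2 * (ξ ⬝ᵥ (d.measInfo i *ᵥ ξ))
      - d.gam ^ 2 * ∑ j ∈ d.V i, ξ ⬝ᵥ (d.linkInfo i j *ᵥ ξ) + ξ ⬝ᵥ (d.Q i *ᵥ ξ)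
      + τ i * (ξ ⬝ᵥ (d.R *ᵥ ξ)) + 2 * (ξ ⬝ᵥ (X i *ᵥ (d.B1 *ᵥ c)))
      + 2 * ∑ j ∈ d.V i, (d.gam ^ 2 * (ξ ⬝ᵥ (d.linkInfo i j *ᵥ v j)) - ξ ⬝ᵥ v j)
      - τ i * (c ⬝ᵥ c)
      - ∑ j ∈ d.V i, (2 * d.δ j / ((d.qdeg j : ℝ) + 1)) * (v j ⬝ᵥ (X j *ᵥ v j)) := by
  have hT : (d.Acl Aρ i)ᵀ * X i = (X i * d.Acl Aρ i)ᵀ := by rw [transpose_mul, hX]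
  simp only [redQF, Smat, hT, add_mulVec, sub_mulVec, dotProduct_add, dotProduct_sub,
    quadForm_transpose, smul_mulVec, dotProduct_smul, one_mulVec, finsetSum_mulVec, dotProduct_sum,
    mulVec_zero, dotProduct_zero, smul_eq_mul, measInfo, linkInfo]
  have hA : ξ ⬝ᵥ ((X i * d.Acl Aρ i) *ᵥ ξ) = ξ ⬝ᵥ (X i *ᵥ (Aρ *ᵥ ξ)) + d.δ i * (ξ ⬝ᵥ (X i *ᵥ ξ))
      + ξ ⬝ᵥ (X i *ᵥ ((d.B2 i * (d.D2 i)ᵀ * (d.E i)⁻¹ * d.C2 i) *ᵥ ξ)) := by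
    rw [← mulVec_mulVec, Acl, add_mulVec, add_mulVec, smul_mulVec, one_mulVec, mulVec_add,
      mulVec_add, mulVec_smul, dotProduct_add, dotProduct_add, dotProduct_smul, smul_eq_mul]
  rw [hA, ← mulVec_mulVec c]
  push_cast
  ring

/-- The coupled LMI at a grid point implies the reduced inequality at nearby parameters. -/
lemma redQF_nonpos_of_feasible {A₀ Aρ : Matrix (Fin n) (Fin n) ℝ} {α : ℝ} {τ θ : Fin N → ℝ}
    {X : Fin N → Matrix (Fin n) (Fin n) ℝ} (h : d.Feasible A₀ α τ θ X)
    (hcov : (α ^ 2 • (1 : Matrix (Fin n) (Fin n) ℝ) - (Aρ - A₀)ᵀ * (Aρ - A₀)).PosSemidef)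
    (i : Fin N) (ξ : Fin n → ℝ) (c : Fin l → ℝ) (v : Fin N → Fin n → ℝ) :
    d.redQF Aρ τ X i ξ 0 0 c v ≤ 0 := by
  obtain ⟨-, hθ, hX, hL⟩ := h
  have hXt := posDef_transpose (hX i)
  have hfull : d.fullQF A₀ α τ θ X i ξ 0 0 c v ((Aρ - A₀) *ᵥ ξ) ≤ 0 := by
    by_cases hz : ξ = 0 ∧ (0 : Fin r0 → ℝ) = 0 ∧ (0 : Fin r → ℝ) = 0 ∧ c = 0 ∧
        (∀ j ∈ d.V i, v j = 0) ∧ (Aρ - A₀) *ᵥ ξ = 0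
    · obtain ⟨h1, -, -, h2, h3, -⟩ := hz
      have hs : ∑ j ∈ d.V i, (2 * d.δ j / ((d.qdeg j : ℝ) + 1)) * (v j ⬝ᵥ (X j *ᵥ v j)) = 0 :=
        Finset.sum_eq_zero fun j hj => by simp [h3 j hj]
      simp [fullQF, redQF, h1, h2, hs]
    · exact (hL i _ _ _ _ _ _ hz).le
  have hq := quadForm_nonneg hcov ξ
  rw [sub_mulVec, smul_mulVec, one_mulVec, dotProduct_sub, dotProduct_smul, ← mulVec_mulVec,
    dotProduct_mulVec ξ ((Aρ - A₀)ᵀ), ← mulVec_transpose, transpose_transpose, smul_eq_mul] at hq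
  have hq' := mul_nonneg (hθ i).le hq
  rw [fullQF, redQF_eq d A₀ τ X i hXt] at hfull
  rw [redQF_eq d Aρ τ X i hXt]
  have hA : ξ ⬝ᵥ (X i *ᵥ ((Aρ - A₀) *ᵥ ξ))
      = ξ ⬝ᵥ (X i *ᵥ (Aρ *ᵥ ξ)) - ξ ⬝ᵥ (X i *ᵥ (A₀ *ᵥ ξ)) := by
    rw [sub_mulVec, mulVec_sub, dotProduct_sub]
  rw [hA] at hfull
  linarith

lemma redQF_combination {Aρ : Matrix (Fin n) (Fin n) ℝ} {τ₁ τ₂ : Fin N → ℝ}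
    {X₁ X₂ : Fin N → Matrix (Fin n) (Fin n) ℝ} {a₁ a₂ : ℝ} (ha : a₁ + a₂ = 1) (i : Fin N)
    (h₁ : (X₁ i)ᵀ = X₁ i) (h₂ : (X₂ i)ᵀ = X₂ i)
    (ξ : Fin n → ℝ) (c : Fin l → ℝ) (v : Fin N → Fin n → ℝ) :
    d.redQF Aρ (fun i => a₁ * τ₁ i + a₂ * τ₂ i) (fun i => a₁ • X₁ i + a₂ • X₂ i) i ξ 0 0 c v
      = a₁ * d.redQF Aρ τ₁ X₁ i ξ 0 0 c v + a₂ * d.redQF Aρ τ₂ X₂ i ξ 0 0 c v := by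
  have hq : ∀ j : Fin N, ∀ v w : Fin n → ℝ, v ⬝ᵥ ((a₁ • X₁ j + a₂ • X₂ j) *ᵥ w)
      = a₁ * (v ⬝ᵥ (X₁ j *ᵥ w)) + a₂ * (v ⬝ᵥ (X₂ j *ᵥ w)) := fun j v w => by
    rw [add_mulVec, smul_mulVec, smul_mulVec, dotProduct_add, dotProduct_smul, dotProduct_smul,
      smul_eq_mul, smul_eq_mul]
  have hsum : ∑ j ∈ d.V i, (2 * d.δ j / ((d.qdeg j : ℝ) + 1)) *
        (a₁ * (v j ⬝ᵥ (X₁ j *ᵥ v j)) + a₂ * (v j ⬝ᵥ (X₂ j *ᵥ v j)))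
      = a₁ * ∑ j ∈ d.V i, (2 * d.δ j / ((d.qdeg j : ℝ) + 1)) * (v j ⬝ᵥ (X₁ j *ᵥ v j))
        + a₂ * ∑ j ∈ d.V i, (2 * d.δ j / ((d.qdeg j : ℝ) + 1)) * (v j ⬝ᵥ (X₂ j *ᵥ v j)) := by
    rw [Finset.mul_sum, Finset.mul_sum, ← Finset.sum_add_distrib]
    exact Finset.sum_congr rfl fun _ _ => by ring
  rw [redQF_eq d _ _ _ i (by simp [h₁, h₂]), redQF_eq d _ _ _ i h₁, redQF_eq d _ _ _ i h₂]
  simp only [hq, hsum]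
  obtain rfl : a₂ = 1 - a₁ := by linarith
  ring

/-- The derivative of `eᵢᵀ Xᵢ eᵢ` along the unperturbed error dynamics with frozen weights,
in terms of the reduced form. -/
lemma two_mul_errorRate_eq {Aρ : Matrix (Fin n) (Fin n) ℝ} (τ : Fin N → ℝ)
    {X : Fin N → Matrix (Fin n) (Fin n) ℝ} (hX : ∀ i, (X i).PosDef) (i : Fin N)
    (e : Fin N → Fin n → ℝ) (c : Fin l → ℝ) :
    2 * (e i ⬝ᵥ (X i *ᵥ (Aρ *ᵥ e i + d.B1 *ᵥ c - (d.Lgain X i *ᵥ (d.C2 i *ᵥ e i)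
        + ∑ j ∈ d.V i, d.Kgain X i j *ᵥ (d.H i j *ᵥ (e i - e j))))))
      = d.redQF Aρ τ X i (e i) 0 0 c e - 2 * d.δ i * (e i ⬝ᵥ (X i *ᵥ e i))
        - ((d.pdeg i : ℝ) + d.qdeg i) * (e i ⬝ᵥ e i) - d.gam ^ 2 * (e i ⬝ᵥ (d.measInfo i *ᵥ e i))
        - d.gam ^ 2 * ∑ j ∈ d.V i, e i ⬝ᵥ (d.linkInfo i j *ᵥ e i) - e i ⬝ᵥ (d.Q i *ᵥ e i)
        - τ i * (e i ⬝ᵥ (d.R *ᵥ e i) - c ⬝ᵥ c) + 2 * ∑ j ∈ d.V i, e i ⬝ᵥ e j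
        + ∑ j ∈ d.V i, (2 * d.δ j / ((d.qdeg j : ℝ) + 1)) * (e j ⬝ᵥ (X j *ᵥ e j)) := by
  have hdet : IsUnit (X i).det := (isUnit_iff_isUnit_det (X i)).1 (hX i).isUnit
  have hL : X i *ᵥ (d.Lgain X i *ᵥ (d.C2 i *ᵥ e i)) = d.gam ^ 2 • (d.measInfo i *ᵥ e i)
      - X i *ᵥ ((d.B2 i * (d.D2 i)ᵀ * (d.E i)⁻¹ * d.C2 i) *ᵥ e i) := by
    simp only [mulVec_mulVec, ← smul_mulVec, ← sub_mulVec]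
    congr 1
    simp only [Lgain, measInfo, Matrix.sub_mul, Matrix.mul_sub, Matrix.smul_mul, Matrix.mul_smul,
      ← Matrix.mul_assoc, mul_nonsing_inv _ hdet, Matrix.one_mul]
  have hK : ∀ j, X i *ᵥ (d.Kgain X i j *ᵥ (d.H i j *ᵥ (e i - e j)))
      = d.gam ^ 2 • (d.linkInfo i j *ᵥ e i) - d.gam ^ 2 • (d.linkInfo i j *ᵥ e j) := fun j => by
    rw [← smul_sub, ← mulVec_sub, ← smul_mulVec, mulVec_mulVec, mulVec_mulVec]
    congr 1
    simp only [Kgain, linkInfo, Matrix.smul_mul, Matrix.mul_smul,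
      ← Matrix.mul_assoc, mul_nonsing_inv _ hdet, Matrix.one_mul]
  rw [redQF_eq d Aρ τ X i (posDef_transpose (hX i))]
  rw [mulVec_sub, mulVec_add, mulVec_add, mulVec_sum]
  simp only [hL, hK, dotProduct_add, dotProduct_sub, dotProduct_sum, dotProduct_smul, smul_eq_mul, Finset.sum_sub_distrib, ← Finset.mul_sum]
  ring

lemma sum_inNeighbours (f : Fin N → ℝ) :
    ∑ i, ∑ j ∈ d.V i, f j = ∑ j, (d.qdeg j : ℝ) * f j := by
  have : ∀ i, ∑ j ∈ d.V i, f j = ∑ j, if j ∈ d.V i then f j else 0 := fun i => by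
    rw [Finset.sum_ite_mem, Finset.univ_inter]
  simp only [this]
  rw [Finset.sum_comm]
  refine Finset.sum_congr rfl fun j _ => ?_
  rw [← Finset.sum_filter, Finset.sum_const, nsmul_eq_mul, qdeg]

lemma sum_cross_le (e : Fin N → Fin n → ℝ) :
    ∑ i, 2 * ∑ j ∈ d.V i, e i ⬝ᵥ e j ≤ ∑ i, ((d.pdeg i : ℝ) + d.qdeg i) * (e i ⬝ᵥ e i) := by
  have h : ∀ i j, 2 * (e i ⬝ᵥ e j) ≤ e i ⬝ᵥ e i + e j ⬝ᵥ e j := fun i j => by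
    have := dotProduct_self_nonneg_real (e i - e j)
    rw [sub_dotProduct, dotProduct_sub, dotProduct_sub, dotProduct_comm (e j) (e i)] at this
    linarith
  calc ∑ i, 2 * ∑ j ∈ d.V i, e i ⬝ᵥ e j
      ≤ ∑ i, ∑ j ∈ d.V i, (e i ⬝ᵥ e i + e j ⬝ᵥ e j) := Finset.sum_le_sum fun i _ => by
        rw [Finset.mul_sum]
        exact Finset.sum_le_sum fun j _ => h i j
    _ = _ := by
      simp only [Finset.sum_add_distrib, add_mul, d.sum_inNeighbours fun j => e j ⬝ᵥ e j,
        Finset.sum_const, nsmul_eq_mul, pdeg]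

lemma sum_errorRate_le (hs : d.Standing) {Aρ : Matrix (Fin n) (Fin n) ℝ} {τ : Fin N → ℝ}
    (hτ : ∀ i, 0 ≤ τ i) {X : Fin N → Matrix (Fin n) (Fin n) ℝ} (hX : ∀ i, (X i).PosDef)
    (e : Fin N → Fin n → ℝ) (c : Fin N → Fin l → ℝ)
    (hred : ∀ i, d.redQF Aρ τ X i (e i) 0 0 (c i) e ≤ 0)
    (hc : ∀ i, c i ⬝ᵥ c i ≤ e i ⬝ᵥ (d.R *ᵥ e i)) :
    ∑ i, (2 * (e i ⬝ᵥ (X i *ᵥ (Aρ *ᵥ e i + d.B1 *ᵥ c i - (d.Lgain X i *ᵥ (d.C2 i *ᵥ e i)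
        + ∑ j ∈ d.V i, d.Kgain X i j *ᵥ (d.H i j *ᵥ (e i - e j)))))) + e i ⬝ᵥ (d.Q i *ᵥ e i))
      ≤ - ∑ i, (2 * d.δ i / ((d.qdeg i : ℝ) + 1)) * (e i ⬝ᵥ (X i *ᵥ e i)) := by
  obtain ⟨-, hE, hF, -, -, -, -⟩ := hs
  have hmeas : ∀ i, 0 ≤ e i ⬝ᵥ (d.measInfo i *ᵥ e i) := fun i =>
    quadForm_nonneg (by
      simpa [measInfo, conjTranspose_eq_transpose_of_trivial] using
        (hE i).inv.posSemidef.conjTranspose_mul_mul_same (d.C2 i)) _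
  have hlink : ∀ i, 0 ≤ ∑ j ∈ d.V i, e i ⬝ᵥ (d.linkInfo i j *ᵥ e i) := fun i =>
    Finset.sum_nonneg fun j hj => quadForm_nonneg (by
      simpa [linkInfo, conjTranspose_eq_transpose_of_trivial] using
        (hF i j hj).inv.posSemidef.conjTranspose_mul_mul_same (d.H i j)) _
  have hterm : ∀ i, 2 * (e i ⬝ᵥ (X i *ᵥ (Aρ *ᵥ e i + d.B1 *ᵥ c i -
        (d.Lgain X i *ᵥ (d.C2 i *ᵥ e i)
        + ∑ j ∈ d.V i, d.Kgain X i j *ᵥ (d.H i j *ᵥ (e i - e j)))))) + e i ⬝ᵥ (d.Q i *ᵥ e i)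
      ≤ - (2 * d.δ i * (e i ⬝ᵥ (X i *ᵥ e i))) - ((d.pdeg i : ℝ) + d.qdeg i) * (e i ⬝ᵥ e i)
        + 2 * ∑ j ∈ d.V i, e i ⬝ᵥ e j
        + ∑ j ∈ d.V i, (2 * d.δ j / ((d.qdeg j : ℝ) + 1)) * (e j ⬝ᵥ (X j *ᵥ e j)) := fun i => by
    rw [d.two_mul_errorRate_eq τ hX i e (c i)]
    have h1 := mul_nonneg (sq_nonneg d.gam) (hmeas i)
    have h2 := mul_nonneg (sq_nonneg d.gam) (hlink i)
    have h3 := mul_nonneg (hτ i) (sub_nonneg.2 (hc i))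
    linarith [hred i]
  refine (Finset.sum_le_sum fun i _ => hterm i).trans ?_
  simp only [Finset.sum_add_distrib, Finset.sum_sub_distrib, d.sum_inNeighbours fun j =>
    (2 * d.δ j / ((d.qdeg j : ℝ) + 1)) * (e j ⬝ᵥ (X j *ᵥ e j)), Finset.sum_neg_distrib]
  have hcross := d.sum_cross_le e
  simp only [Finset.sum_add_distrib, add_mul] at hcross ⊢
  have hδ : ∑ i, 2 * d.δ i * (e i ⬝ᵥ (X i *ᵥ e i))
      = ∑ i, (d.qdeg i : ℝ) * ((2 * d.δ i / ((d.qdeg i : ℝ) + 1)) * (e i ⬝ᵥ (X i *ᵥ e i)))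
        + ∑ i, (2 * d.δ i / ((d.qdeg i : ℝ) + 1)) * (e i ⬝ᵥ (X i *ᵥ e i)) := by
    rw [← Finset.sum_add_distrib]
    refine Finset.sum_congr rfl fun i _ => ?_
    have : (d.qdeg i : ℝ) + 1 ≠ 0 := by positivity
    field_simp
  linarith

end Inequalities

lemma hasDerivAt_dotProduct {k : ℕ} {f g : ℝ → Fin k → ℝ} {f' g' : Fin k → ℝ} {t : ℝ}
    (hf : HasDerivAt f f' t) (hg : HasDerivAt g g' t) :
    HasDerivAt (fun z => f z ⬝ᵥ g z) (f' ⬝ᵥ g t + f t ⬝ᵥ g') t := by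
  have h := HasDerivAt.fun_sum (u := Finset.univ) fun p _ =>
    (hasDerivAt_pi.1 hf p).fun_mul (hasDerivAt_pi.1 hg p)
  rw [Finset.sum_add_distrib] at h
  exact h

lemma hasDerivAt_mulVec {k k' : ℕ} (M : Matrix (Fin k') (Fin k) ℝ) {f : ℝ → Fin k → ℝ}
    {f' : Fin k → ℝ} {t : ℝ} (hf : HasDerivAt f f' t) :
    HasDerivAt (fun z => M *ᵥ f z) (M *ᵥ f') t :=
  hasDerivAt_pi.2 fun p => by
    have h := hasDerivAt_dotProduct (hasDerivAt_const t (M p)) hf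
    rw [zero_dotProduct, zero_add] at h
    exact h

lemma hasDerivAt_quadForm {k : ℕ} {X : Matrix (Fin k) (Fin k) ℝ} (hX : Xᵀ = X)
    {f : ℝ → Fin k → ℝ} {f' : Fin k → ℝ} {t : ℝ} (hf : HasDerivAt f f' t) :
    HasDerivAt (fun z => f z ⬝ᵥ (X *ᵥ f z)) (2 * (f t ⬝ᵥ (X *ᵥ f'))) t := by
  convert hasDerivAt_dotProduct hf (hasDerivAt_mulVec X hf) using 1
  rw [dotProduct_mulVec_symm hX f' (f t), two_mul]

lemma exists_pos_le {ι : Type*} (s : Finset ι) (f : ι → ℝ) (hf : ∀ i ∈ s, 0 < f i) :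
    ∃ μ > 0, ∀ i ∈ s, μ ≤ f i := by
  rcases s.eq_empty_or_nonempty with rfl | hs
  · exact ⟨1, one_pos, by simp⟩
  · obtain ⟨j, hj, hmin⟩ := s.exists_min_image f hs
    exact ⟨f j, hf j hj, hmin⟩

lemma continuousOn_of_abs_sub_le {f : ℝ → ℝ} {C : ℝ} (hC : 0 ≤ C) {S : Set ℝ}
    (h : ∀ s ∈ S, ∀ s' ∈ S, |f s - f s'| ≤ C * |s - s'|) : ContinuousOn f S :=
  (LipschitzOnWith.of_dist_le_mul (K := ⟨C, hC⟩) fun s hs s' hs' => h s hs s' hs').continuousOn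

section Dynamics

variable {n l m r r0 N : ℕ} (d : NetData n l m r r0 N)

lemma hasDerivAt_error {Aρ : ℝ → Matrix (Fin n) (Fin n) ℝ} {φ : (Fin n → ℝ) → Fin l → ℝ}
    {X : ℝ → Fin N → Matrix (Fin n) (Fin n) ℝ} {x : ℝ → Fin n → ℝ} {xa : Fin N → ℝ → Fin n → ℝ}
    (hcl : d.ClosedLoop Aρ φ (fun _ _ => 0) (fun t => d.Kgain (X t)) (fun t => d.Lgain (X t))
      (fun _ => 0) (fun _ _ => 0) (fun _ _ _ => 0) x xa) (i : Fin N) {t : ℝ} (ht : 0 ≤ t) :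
    HasDerivAt (fun z => x z - xa i z)
      (Aρ t *ᵥ (x t - xa i t) + d.B1 *ᵥ (φ (x t) - φ (xa i t))
        - (d.Lgain (X t) i *ᵥ (d.C2 i *ᵥ (x t - xa i t))
        + ∑ j ∈ d.V i, d.Kgain (X t) i j *ᵥ (d.H i j *ᵥ ((x t - xa i t) - (x t - xa j t))))) t := by
  refine ((hcl.1 t ht).fun_sub (hcl.2 i t ht)).congr_deriv ?_
  simp only [mulVec_zero, add_zero, sub_sub_sub_cancel_left, mulVec_sub]
  abel

/-- A sum of quadratic forms with time-varying, Lipschitz weights decays at the rate dictated by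
the frozen-weight derivative plus the worst-case drift of the weights. -/
lemma sum_quadForm_slope_lt {e : Fin N → ℝ → Fin n → ℝ} {e' : Fin N → Fin n → ℝ}
    {X : Fin N → ℝ → Matrix (Fin n) (Fin n) ℝ} {ρ : ℝ → ℝ} {ρd t rr : ℝ} {S : Set ℝ}
    {L : Fin N → ℝ} (ht : 0 ≤ t) (he : ∀ i, HasDerivAt (e i) (e' i) t)
    (hρ : HasDerivAt ρ ρd t) (hmem : ∀ z, 0 ≤ z → ρ z ∈ S) (hsymm : ∀ i, (X i (ρ t))ᵀ = X i (ρ t))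
    (hLip : ∀ i v, ∀ s ∈ S, ∀ s' ∈ S,
      |v ⬝ᵥ (X i s *ᵥ v) - v ⬝ᵥ (X i s' *ᵥ v)| ≤ (L i * (v ⬝ᵥ v)) * |s - s'|)
    (hr : ∑ i, (2 * (e i t ⬝ᵥ (X i (ρ t) *ᵥ e' i)) + L i * (e i t ⬝ᵥ e i t) * |ρd|) < rr) :
    ∀ᶠ z in nhdsWithin t (Ioi t), (z - t)⁻¹ * (∑ i, e i z ⬝ᵥ (X i (ρ z) *ᵥ e i z)
      - ∑ i, e i t ⬝ᵥ (X i (ρ t) *ᵥ e i t)) < rr := by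
  have hsub : nhdsWithin t (Ioi t) ≤ nhdsWithin t {t}ᶜ :=
    nhdsWithin_mono t fun z hz => ne_of_gt hz
  have hlim : Tendsto (fun z => ∑ i, (slope (fun z => e i z ⬝ᵥ (X i (ρ t) *ᵥ e i z)) t z
      + L i * (e i z ⬝ᵥ e i z) * |slope ρ t z|)) (nhdsWithin t (Ioi t))
      (nhds (∑ i, (2 * (e i t ⬝ᵥ (X i (ρ t) *ᵥ e' i)) + L i * (e i t ⬝ᵥ e i t) * |ρd|))) := by
    refine tendsto_finsetSum _ fun i _ => Tendsto.add ?_ (Tendsto.mul (Tendsto.const_mul _ ?_) ?_)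
    · exact (hasDerivAt_quadForm (hsymm i) (he i)).tendsto_slope.mono_left hsub
    · exact (hasDerivAt_dotProduct (he i) (he i)).continuousAt.tendsto.mono_left nhdsWithin_le_nhds
    · exact (hρ.tendsto_slope.mono_left hsub).abs
  filter_upwards [hlim.eventually_lt_const hr, self_mem_nhdsWithin] with z hz htz
  have hzt : 0 < z - t := sub_pos.2 htz
  refine lt_of_le_of_lt ?_ hz
  rw [← Finset.sum_sub_distrib, Finset.mul_sum]
  refine Finset.sum_le_sum fun i _ => ?_
  have h := (le_abs_self _).trans
    (hLip i (e i z) (ρ z) (hmem z (ht.trans (le_of_lt htz))) (ρ t) (hmem t ht))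
  rw [slope_def_field, slope_def_field, abs_div, abs_of_pos hzt, inv_mul_eq_div, ← mul_div_assoc,
    ← add_div]
  gcongr
  linarith

end Dynamics
end NetData

/-- **Theorem 2, property (i) (STATEMENT 7).** Under the rate condition (23),
the interpolated gain-scheduled protocol renders the unperturbed
synchronization-error dynamics exponentially stable:
`‖x(t) − xᵢ(t)‖² ≤ c e^{−ωt}`. -/
theorem interpolated_exponential_stability
    {n l m r r0 N : ℕ} (hN : 0 < N) (d : NetData n l m r r0 N) (hstand : d.Standing)
    (φ : (Fin n → ℝ) → Fin l → ℝ) (hφ : d.LipOK φ)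
    -- the parameter interval Γ = [ρmin, ρmax], the continuous matrix function A(·)
    -- and the continuously differentiable scheduling signal ρ(·) with values in Γ
    (ρmin ρmax : ℝ) (hΓ : ρmin < ρmax)
    (Afun : ℝ → Matrix (Fin n) (Fin n) ℝ) (hAcont : ContinuousOn Afun (Icc ρmin ρmax))
    (ρfun ρ' : ℝ → ℝ) (hρmem : ∀ t ∈ Ici (0:ℝ), ρfun t ∈ Icc ρmin ρmax)
    (hρder : ∀ t, HasDerivAt ρfun (ρ' t) t) (hρ'cont : Continuous ρ')
    -- grid points ρ¹ < … < ρᴹ (indexed 0,…,M−1) and overlap points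
    -- ρᵏ < ρ̲ᵏ⁺¹ (= u k) < ρ̄ᵏ (= b k) < ρᵏ⁺¹
    (M : ℕ) (hM : 2 ≤ M) (grid u b : ℕ → ℝ) (αg : ℕ → ℝ)
    (hg0 : grid 0 = ρmin) (hgM : grid (M - 1) = ρmax)
    (hcorner : ∀ k, k + 1 ≤ M - 1 →
      grid k < u k ∧ u k < b k ∧ b k < grid (k + 1))
    (hαg : ∀ k ≤ M - 1, 0 < αg k)
    -- the covering conditions (19), (20)
    (hcovA : ∀ k, k + 1 ≤ M - 1 → ∀ s ∈ Ico (grid k) (b k),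
      ((αg k) ^ 2 • (1 : Matrix (Fin n) (Fin n) ℝ)
        - (Afun s - Afun (grid k))ᵀ * (Afun s - Afun (grid k))).PosSemidef)
    (hcovB : ∀ k, k + 1 ≤ M - 1 → ∀ s ∈ Ioc (u k) (grid (k + 1)),
      ((αg (k + 1)) ^ 2 • (1 : Matrix (Fin n) (Fin n) ℝ)
        - (Afun s - Afun (grid (k + 1)))ᵀ * (Afun s - Afun (grid (k + 1)))).PosSemidef)
    -- feasible solutions of the coupled LMIs (12) at each grid point
    (τg θg : ℕ → Fin N → ℝ) (Xg : ℕ → Fin N → Matrix (Fin n) (Fin n) ℝ)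
    (hfeas : ∀ k ≤ M - 1, d.Feasible (Afun (grid k)) (αg k) (τg k) (θg k) (Xg k))
    -- the piecewise-affine interpolation (21) of the matrices X_{i,ρ}
    (Xρ : Fin N → ℝ → Matrix (Fin n) (Fin n) ℝ)
    (hXρ1 : ∀ k, k + 1 ≤ M - 1 → ∀ i, ∀ s ∈ Icc (grid k) (u k), Xρ i s = Xg k i)
    (hXρ2 : ∀ k, k + 1 ≤ M - 1 → ∀ i, ∀ s ∈ Icc (u k) (b k),
      Xρ i s = ((b k - s) / (b k - u k)) • Xg k i
        + ((s - u k) / (b k - u k)) • Xg (k + 1) i)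
    (hXρ3 : ∀ k, k + 1 ≤ M - 1 → ∀ i, ∀ s ∈ Icc (b k) (grid (k + 1)),
      Xρ i s = Xg (k + 1) i)
    -- ρ(0) is not a corner point, and the set of times at which ρ(t) is a corner
    -- point has zero Lebesgue measure
    (hρ0corner : ¬ ∃ k, k + 1 ≤ M - 1 ∧ (ρfun 0 = u k ∨ ρfun 0 = b k)
        ∧ ρmin < ρfun 0 ∧ ρfun 0 < ρmax)
    (hnull : volume {t : ℝ | ∃ k, k + 1 ≤ M - 1 ∧ (ρfun t = u k ∨ ρfun t = b k)
        ∧ ρmin < ρfun t ∧ ρfun t < ρmax} = 0)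
    -- the rate-of-variation bound (23):
    -- sup|ρ̇| ≤ minᵢ λ_min(Qᵢ)·[sup_k ‖X_{i,ρᵏ⁺¹} − X_{i,ρᵏ}‖/(ρ̄ᵏ − ρ̲ᵏ⁺¹)]⁻¹,
    -- stated via the Rayleigh-quotient characterization of λ_min(Qᵢ)
    (hrate : ∀ t ∈ Ici (0:ℝ), ∀ i, ∀ k, k + 1 ≤ M - 1 → ∀ ξ : Fin n → ℝ,
      |ρ' t| * (frobNorm (Xg (k + 1) i - Xg k i) / (b k - u k)) * (ξ ⬝ᵥ ξ)
        ≤ ξ ⬝ᵥ (d.Q i *ᵥ ξ))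
    -- a solution of the closed-loop system with the interpolated gains (22)
    (x : ℝ → Fin n → ℝ) (xa : Fin N → ℝ → Fin n → ℝ)
    (hcl : d.ClosedLoop (fun t => Afun (ρfun t)) φ (fun _ _ => 0)
      (fun t => d.Kgain (fun i => Xρ i (ρfun t)))
      (fun t => d.Lgain (fun i => Xρ i (ρfun t))) (fun _ => 0) (fun _ _ => 0) (fun _ _ _ => 0) x xa)
    :
    ∃ c > (0:ℝ), ∃ ω > (0:ℝ), ∀ i, ∀ t ∈ Ici (0:ℝ),
      (x t - xa i t) ⬝ᵥ (x t - xa i t) ≤ c * Real.exp (-ω * t) := by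
  have hM1 : 1 ≤ M - 1 := by omega
  have hmem : ∀ t, 0 ≤ t → ρfun t ∈ Icc (grid 0) (grid (M - 1)) := fun t ht => by
    rw [hg0, hgM]
    exact hρmem t ht
  have hbu : ∀ k, k + 1 ≤ M - 1 → 0 < b k - u k := fun k hk => sub_pos.2 (hcorner k hk).2.1
  have hXpos : ∀ k ≤ M - 1, ∀ i, (Xg k i).PosDef := fun k hk => (hfeas k hk).2.2.1
  -- uniform coercivity of the grid solutions
  obtain ⟨μ, hμ, hcoer⟩ : ∃ μ > 0, ∀ k ≤ M - 1, ∀ i, ∀ v : Fin n → ℝ,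
      μ * (v ⬝ᵥ v) ≤ v ⬝ᵥ (Xg k i *ᵥ v) := by
    have h : ∀ p : ℕ × Fin N, ∃ μ > 0, p.1 ≤ M - 1 →
        ∀ v : Fin n → ℝ, μ * (v ⬝ᵥ v) ≤ v ⬝ᵥ (Xg p.1 p.2 *ᵥ v) := fun p => by
      by_cases hp : p.1 ≤ M - 1
      · obtain ⟨μ, hμ, h⟩ := NetData.exists_coercive (hXpos p.1 hp p.2)
        exact ⟨μ, hμ, fun _ => h⟩
      · exact ⟨1, one_pos, fun h => absurd h hp⟩
    choose f hf hfc using h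
    obtain ⟨μ, hμ, hle⟩ := NetData.exists_pos_le
      (Finset.range M ×ˢ (Finset.univ : Finset (Fin N))) f fun p _ => hf p
    refine ⟨μ, hμ, fun k hk i v => le_trans ?_ (hfc (k, i) hk v)⟩
    exact mul_le_mul_of_nonneg_right (hle (k, i) (by simp; omega))
      (NetData.dotProduct_self_nonneg_real v)
  -- the reduced inequality along the interpolation
  have hinterp : ∀ s ∈ Icc (grid 0) (grid (M - 1)), ∃ τ : Fin N → ℝ, (∀ i, 0 ≤ τ i) ∧
      (∀ i, (Xρ i s).PosDef) ∧ (∀ i v, μ * (v ⬝ᵥ v) ≤ v ⬝ᵥ (Xρ i s *ᵥ v)) ∧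
      ∀ i ξ c v, d.redQF (Afun s) τ (fun i => Xρ i s) i ξ 0 0 c v ≤ 0 := by
    intro s hs
    obtain ⟨k, hk, hsk⟩ := NetData.exists_grid_interval (M - 1) le_rfl hM1 hs
    obtain ⟨hgu, hub, hbg⟩ := hcorner k hk
    have hk' : k ≤ M - 1 := by omega
    rcases le_or_gt s (u k) with hsu | hsu
    · have hX : (fun i => Xρ i s) = Xg k := funext fun i => hXρ1 k hk i s ⟨hsk.1, hsu⟩
      refine ⟨τg k, fun i => ((hfeas k hk').1 i).le, fun i => ?_, fun i v => ?_, ?_⟩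
      · rw [congrFun hX i]; exact hXpos k hk' i
      · rw [congrFun hX i]; exact hcoer k hk' i v
      · rw [hX]
        exact d.redQF_nonpos_of_feasible (hfeas k hk') (hcovA k hk s ⟨hsk.1, hsu.trans_lt hub⟩)
    rcases le_or_gt (b k) s with hsb | hsb
    · have hX : (fun i => Xρ i s) = Xg (k + 1) := funext fun i => hXρ3 k hk i s ⟨hsb, hsk.2⟩
      refine ⟨τg (k + 1), fun i => ((hfeas _ hk).1 i).le, fun i => ?_, fun i v => ?_, ?_⟩
      · rw [congrFun hX i]; exact hXpos _ hk i
      · rw [congrFun hX i]; exact hcoer _ hk i v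
      · rw [hX]
        exact d.redQF_nonpos_of_feasible (hfeas _ hk) (hcovB k hk s ⟨hsu, hsk.2⟩)
    set a₁ := (b k - s) / (b k - u k) with ha₁
    set a₂ := (s - u k) / (b k - u k) with ha₂
    have h₁ : 0 < a₁ := div_pos (sub_pos.2 hsb) (hbu k hk)
    have h₂ : 0 < a₂ := div_pos (sub_pos.2 hsu) (hbu k hk)
    have h₁₂ : a₁ + a₂ = 1 := by
      rw [ha₁, ha₂, ← add_div, sub_add_sub_cancel, div_self (hbu k hk).ne']
    have hX : (fun i => Xρ i s) = fun i => a₁ • Xg k i + a₂ • Xg (k + 1) i :=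
      funext fun i => hXρ2 k hk i s ⟨hsu.le, hsb.le⟩
    refine ⟨fun i => a₁ * τg k i + a₂ * τg (k + 1) i, fun i => ?_, fun i => ?_, fun i v => ?_,
      fun i ξ c v => ?_⟩
    · exact add_nonneg (mul_nonneg h₁.le ((hfeas k hk').1 i).le)
        (mul_nonneg h₂.le ((hfeas _ hk).1 i).le)
    · rw [congrFun hX i]
      exact ((hXpos k hk' i).smul h₁).add ((hXpos _ hk i).smul h₂)
    · rw [congrFun hX i, add_mulVec, smul_mulVec, smul_mulVec, dotProduct_add, dotProduct_smul,
        dotProduct_smul, smul_eq_mul, smul_eq_mul]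
      calc μ * (v ⬝ᵥ v) = a₁ * (μ * (v ⬝ᵥ v)) + a₂ * (μ * (v ⬝ᵥ v)) := by
            rw [← add_mul, h₁₂, one_mul]
        _ ≤ _ := add_le_add (mul_le_mul_of_nonneg_left (hcoer k hk' i v) h₁.le)
            (mul_le_mul_of_nonneg_left (hcoer _ hk i v) h₂.le)
    · rw [hX, d.redQF_combination h₁₂ i (NetData.posDef_transpose (hXpos k hk' i))
        (NetData.posDef_transpose (hXpos _ hk i))]
      have e₁ := d.redQF_nonpos_of_feasible (hfeas k hk') (hcovA k hk s ⟨hsk.1, hsb⟩) i ξ c v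
      have e₂ := d.redQF_nonpos_of_feasible (hfeas _ hk) (hcovB k hk s ⟨hsu, hsk.2⟩) i ξ c v
      exact add_nonpos (mul_nonpos_of_nonneg_of_nonpos h₁.le e₁)
        (mul_nonpos_of_nonneg_of_nonpos h₂.le e₂)
  -- the steepest slope of the interpolation
  have hslope : ∀ i, ∃ L : ℝ, 0 ≤ L ∧
      (∀ k, k + 1 ≤ M - 1 → frobNorm (Xg (k + 1) i - Xg k i) / (b k - u k) ≤ L) ∧
      ∀ t, 0 ≤ t → ∀ ξ : Fin n → ℝ, L * (ξ ⬝ᵥ ξ) * |ρ' t| ≤ ξ ⬝ᵥ (d.Q i *ᵥ ξ) := fun i => by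
    obtain ⟨k, hk, hmax⟩ := (Finset.range (M - 1)).exists_max_image
      (fun k => frobNorm (Xg (k + 1) i - Xg k i) / (b k - u k))
      (Finset.nonempty_range_iff.2 (by omega))
    rw [Finset.mem_range] at hk
    refine ⟨_, div_nonneg (NetData.frobNorm_nonneg _) (hbu k hk).le,
      fun j hj => hmax j (Finset.mem_range.2 hj), fun t ht ξ => ?_⟩
    have := hrate t ht i k hk ξ
    linarith
  choose L hL0 hLk hLQ using hslope
  have hLip : ∀ i (v : Fin n → ℝ), ∀ s ∈ Icc (grid 0) (grid (M - 1)),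
      ∀ s' ∈ Icc (grid 0) (grid (M - 1)),
      |v ⬝ᵥ (Xρ i s *ᵥ v) - v ⬝ᵥ (Xρ i s' *ᵥ v)| ≤ (L i * (v ⬝ᵥ v)) * |s - s'| := fun i v => by
    have hv := NetData.dotProduct_self_nonneg_real v
    refine NetData.interpolation_lipschitz (g := fun k => v ⬝ᵥ (Xg k i *ᵥ v))
      (mul_nonneg (hL0 i) hv) hcorner ?_ ?_ ?_ ?_ (M - 1) le_rfl
    · intro k hk s hs; rw [hXρ1 k hk i s hs]
    · intro k hk s hs
      rw [hXρ2 k hk i s hs, add_mulVec, smul_mulVec, smul_mulVec, dotProduct_add,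
        dotProduct_smul, dotProduct_smul, smul_eq_mul, smul_eq_mul]
    · intro k hk s hs; rw [hXρ3 k hk i s hs]
    · intro k hk
      rw [← dotProduct_sub, ← sub_mulVec]
      calc _ ≤ frobNorm (Xg (k + 1) i - Xg k i) * (v ⬝ᵥ v) / (b k - u k) :=
            div_le_div_of_nonneg_right (NetData.abs_quadForm_le _ v) (hbu k hk).le
        _ = frobNorm (Xg (k + 1) i - Xg k i) / (b k - u k) * (v ⬝ᵥ v) := by ring
        _ ≤ _ := mul_le_mul_of_nonneg_right (hLk i k hk) hv
  have hXcont : ∀ i p q, ContinuousOn (fun s => Xρ i s p q) (Icc (grid 0) (grid (M - 1))) :=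
      fun i p q => by
    refine NetData.continuousOn_of_abs_sub_le (hL0 i)
      (NetData.interpolation_lipschitz (g := fun k => Xg k i p q)
        (hL0 i) hcorner ?_ ?_ ?_ ?_ (M - 1) le_rfl)
    · intro k hk s hs; rw [hXρ1 k hk i s hs]
    · intro k hk s hs; rw [hXρ2 k hk i s hs]; simp
    · intro k hk s hs; rw [hXρ3 k hk i s hs]
    · intro k hk
      exact (div_le_div_of_nonneg_right
        (NetData.abs_entry_le_frobNorm (Xg (k + 1) i - Xg k i) p q) (hbu k hk).le).trans
        (hLk i k hk)
  obtain ⟨ω, hω, hωle⟩ := NetData.exists_pos_le (Finset.univ : Finset (Fin N))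
    (fun i => 2 * d.δ i / ((d.qdeg i : ℝ) + 1)) fun i _ => by
      have := hstand.2.2.2.2.2.1 i
      positivity
  have hder := fun i t (ht : 0 ≤ t) =>
    d.hasDerivAt_error (X := fun t i => Xρ i (ρfun t)) hcl i ht
  set e : Fin N → ℝ → Fin n → ℝ := fun i z => x z - xa i z with he
  set W : ℝ → ℝ := fun z => ∑ i, e i z ⬝ᵥ (Xρ i (ρfun z) *ᵥ e i z) with hW
  have hterm : ∀ t, 0 ≤ t → ∀ i, μ * (e i t ⬝ᵥ e i t) ≤ e i t ⬝ᵥ (Xρ i (ρfun t) *ᵥ e i t) :=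
    fun t ht i => by
      obtain ⟨-, -, -, h, -⟩ := hinterp (ρfun t) (hmem t ht)
      exact h i _
  have hterm0 : ∀ t, 0 ≤ t → ∀ i, 0 ≤ e i t ⬝ᵥ (Xρ i (ρfun t) *ᵥ e i t) := fun t ht i =>
    (mul_nonneg hμ.le (NetData.dotProduct_self_nonneg_real _)).trans (hterm t ht i)
  have hWcont : ContinuousOn W (Ici 0) := by
    have hecont : ∀ i p, ContinuousOn (fun z => e i z p) (Ici 0) := fun i p z hz =>
      (hasDerivAt_pi.1 (hder i z hz) p).continuousAt.continuousWithinAt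
    have hρcont : ContinuousOn ρfun (Ici 0) := fun z _ =>
      (hρder z).continuousAt.continuousWithinAt
    refine continuousOn_finsetSum _ fun i _ => ?_
    simp only [dotProduct, mulVec]
    exact continuousOn_finsetSum _ fun p _ => (hecont i p).mul
      (continuousOn_finsetSum _ fun q _ =>
        ((hXcont i p q).comp hρcont fun z hz => hmem z hz).mul (hecont i q))
  have hdecay : ∀ t, 0 ≤ t → W t ≤ W 0 * Real.exp (-ω * t) := by
    intro t ht
    have h := le_gronwallBound_of_liminf_deriv_right_le (f := W) (f' := fun z => -ω * W z)
      (δ := W 0) (K := -ω) (ε := 0) (a := 0) (b := t) (hWcont.mono Icc_subset_Ici_self)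
      (fun z hz rr hrr => ?_) le_rfl (fun z _ => by simp) t ⟨ht, le_rfl⟩
    · rwa [gronwallBound_ε0, sub_zero] at h
    · refine (NetData.sum_quadForm_slope_lt hz.1 (fun i => hder i z hz.1) (hρder z) hmem ?_ hLip
        (lt_of_le_of_lt ?_ hrr)).frequently
      · obtain ⟨-, -, h, -, -⟩ := hinterp (ρfun z) (hmem z hz.1)
        exact fun i => NetData.posDef_transpose (h i)
      · obtain ⟨τ, hτ, hpos, -, hred⟩ := hinterp (ρfun z) (hmem z hz.1)
        have hrate' := d.sum_errorRate_le hstand hτ hpos (fun i => e i z)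
          (fun i => φ (x z) - φ (xa i z)) (fun i => hred i _ _ _) (fun i => hφ _ _)
        refine le_trans (Finset.sum_le_sum fun i _ => add_le_add_right (hLQ i z hz.1 _) _)
          (hrate'.trans ?_)
        rw [neg_mul, neg_le_neg_iff, hW, Finset.mul_sum]
        exact Finset.sum_le_sum fun i hi =>
          mul_le_mul_of_nonneg_right (hωle i hi) (hterm0 z hz.1 i)
  have hW0 : 0 ≤ W 0 := Finset.sum_nonneg fun i _ => hterm0 0 le_rfl i
  refine ⟨W 0 / μ + 1, by positivity, ω, hω, fun i t ht => ?_⟩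
  have h1 : μ * (e i t ⬝ᵥ e i t) ≤ W 0 * Real.exp (-ω * t) :=
    (hterm t ht i).trans ((Finset.single_le_sum (f := fun i => e i t ⬝ᵥ (Xρ i (ρfun t) *ᵥ e i t))
      (fun j _ => hterm0 t ht j) (Finset.mem_univ i)).trans (hdecay t ht))
  calc e i t ⬝ᵥ e i t ≤ W 0 * Real.exp (-ω * t) / μ := (le_div_iff₀' hμ).2 h1
    _ ≤ (W 0 / μ + 1) * Real.exp (-ω * t) := by
      rw [add_mul, div_mul_eq_mul_div, one_mul]
      exact le_add_of_nonneg_right (Real.exp_pos _).le
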